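/- arXiv:1909.01756 — 9 statements merged into one kernel-verified Lean document; each statement's English description precedes it below -/
import Mathlib

section
/- Let K, L, N be positive integers with L ≤ K ≤ 2L. For a real number M ≥ 0 define R_ub(M) = K − (K − (K−L)²/K)·(MK/N) if 0 ≤ M ≤ N/K, R_ub(M) = ((K−L)²/K)·(2 − MK/N) if N/K ≤ M ≤ 2N/K, and R_ub(M) = 0 if M ≥ 2N/K; likewise define R_lb(M) = K − (K − (K−L)(K−L+1)/(2K))·(MK/N) if 0 ≤ M ≤ N/K, R_lb(M) = ((K−L)(K−L+1)/(2K))·(2 − MK/N) if N/K ≤ M ≤ 2N/K, and R_lb(M) = 0 if M ≥ 2N/K. Then R_ub(M) ≤ 2·R_lb(M) for every real M ≥ 0. -/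
/-- Order-optimality gap for multi-access coded caching with `L ≥ K/2`:
the achievable rate `R_ub` is at most twice the lower bound `R_lb`. -/
theorem rub_le_two_mul_rlb
    (K L N : ℕ) (hK : 0 < K) (hL : 0 < L) (hN : 0 < N)
    (hLK : L ≤ K) (hK2L : K ≤ 2 * L)
    (Rub Rlb : ℝ → ℝ)
    (hub1 : ∀ M : ℝ, 0 ≤ M → M ≤ (N : ℝ) / K →
      Rub M = (K : ℝ) - ((K : ℝ) - ((K : ℝ) - L) ^ 2 / K) * (M * K / N))
    (hub2 : ∀ M : ℝ, (N : ℝ) / K ≤ M → M ≤ 2 * (N : ℝ) / K →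
      Rub M = (((K : ℝ) - L) ^ 2 / K) * (2 - M * K / N))
    (hub3 : ∀ M : ℝ, 2 * (N : ℝ) / K ≤ M → Rub M = 0)
    (hlb1 : ∀ M : ℝ, 0 ≤ M → M ≤ (N : ℝ) / K →
      Rlb M = (K : ℝ) - ((K : ℝ) - ((K : ℝ) - L) * ((K : ℝ) - L + 1) / (2 * K)) * (M * K / N))
    (hlb2 : ∀ M : ℝ, (N : ℝ) / K ≤ M → M ≤ 2 * (N : ℝ) / K →
      Rlb M = (((K : ℝ) - L) * ((K : ℝ) - L + 1) / (2 * K)) * (2 - M * K / N))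
    (hlb3 : ∀ M : ℝ, 2 * (N : ℝ) / K ≤ M → Rlb M = 0) :
    ∀ M : ℝ, 0 ≤ M → Rub M ≤ 2 * Rlb M := by
  intro M hM
  have hK' : (0 : ℝ) < K := by exact_mod_cast hK
  have hN' : (0 : ℝ) < N := by exact_mod_cast hN
  have hd : (0 : ℝ) ≤ (K : ℝ) - L := sub_nonneg.2 (by exact_mod_cast hLK)
  have ht : 0 ≤ M * K / N := by positivity
  have hcoeff : ((K : ℝ) - L) ^ 2 / K ≤
      2 * (((K : ℝ) - L) * ((K : ℝ) - L + 1) / (2 * K)) := by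
    have hdiff : 2 * (((K : ℝ) - L) * ((K : ℝ) - L + 1) / (2 * K)) =
        ((K : ℝ) - L) ^ 2 / K + ((K : ℝ) - L) / K := by
      field_simp
    have : 0 ≤ ((K : ℝ) - L) / K := by positivity
    linarith
  rcases le_total M ((N : ℝ) / K) with h | h
  · have ht1 : M * K / N ≤ 1 := by
      rw [div_le_one hN']
      exact (le_div_iff₀ hK').1 h
    rw [hub1 M hM h, hlb1 M hM h]
    linarith [mul_le_mul_of_nonneg_right hcoeff ht, mul_nonneg hK'.le (sub_nonneg.2 ht1)]
  rcases le_total M (2 * (N : ℝ) / K) with h' | h'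
  · have ht2 : M * K / N ≤ 2 := by
      rw [div_le_iff₀ hN']
      exact (le_div_iff₀ hK').1 h'
    rw [hub2 M h h', hlb2 M h h']
    linarith [mul_le_mul_of_nonneg_right hcoeff (sub_nonneg.2 ht2)]
  · rw [hub3 M h', hlb3 M h', mul_zero]
end

section
/- Let K, L, N be positive integers with K ≤ 2L and L < K, and let M ≥ 0 and R be real numbers. Suppose x₀ ≥ 0 and x₁ ≥ 0 are real, x : ℕ × ℕ → ℝ satisfies x(i,j) ≥ 0 for all integers j, i with 2 ≤ j ≤ K−L and j−1 ≤ i ≤ K−L−1, and y : ℕ → ℝ satisfies y(j) ≥ 0 for all 2 ≤ j ≤ K. Assume: (i) x₀ + x₁ + Σ_{j=2}^{K−L} Σ_{i=j−1}^{K−L−1} x(i,j) + Σ_{j=2}^{K} y(j) = N; (ii) x₁ + Σ_{j=2}^{K−L} Σ_{i=j−1}^{K−L−1} j·x(i,j) + Σ_{j=2}^{K} j·y(j) ≤ K·M; (iii) R ≥ (K/N)·x₀ + ((K−L)(K−L+1)/(2NK))·x₁ + Σ_{j=2}^{K−L} Σ_{i=j−1}^{K−L−1} ((K−L−i)(K−L+1−i)/(2NK))·x(i,j).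 Then R ≥ K − (K − (K−L)(K−L+1)/(2K))·(MK/N). -/
open Finset

/-- Converse bound (first regime) for the `(N,K,L)`-CCDN with `K/2 ≤ L < K`:
any uncoded placement satisfying the file-size, cache-capacity, and
index-coding cut-set constraints has rate
`R ≥ K − (K − (K−L)(K−L+1)/(2K))·(MK/N)`. -/
theorem ccdn_lower_bound_first_regime
    (K L N : ℕ) (hK : 0 < K) (hL : 0 < L) (hN : 0 < N)
    (hK2L : K ≤ 2 * L) (hLK : L < K)
    (M R : ℝ) (hM : 0 ≤ M)
    (x0 x1 : ℝ) (hx0 : 0 ≤ x0) (hx1 : 0 ≤ x1)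
    (x : ℕ × ℕ → ℝ)
    (hx : ∀ j i : ℕ, 2 ≤ j → j ≤ K - L → j - 1 ≤ i → i ≤ K - L - 1 → 0 ≤ x (i, j))
    (y : ℕ → ℝ) (hy : ∀ j : ℕ, 2 ≤ j → j ≤ K → 0 ≤ y j)
    (h1 : x0 + x1
        + (∑ j ∈ Icc 2 (K - L), ∑ i ∈ Icc (j - 1) (K - L - 1), x (i, j))
        + (∑ j ∈ Icc 2 K, y j) = (N : ℝ))
    (h2 : x1
        + (∑ j ∈ Icc 2 (K - L), ∑ i ∈ Icc (j - 1) (K - L - 1), (j : ℝ) * x (i, j))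
        + (∑ j ∈ Icc 2 K, (j : ℝ) * y j) ≤ (K : ℝ) * M)
    (h3 : R ≥ ((K : ℝ) / N) * x0
        + (((K : ℝ) - L) * ((K : ℝ) - L + 1) / (2 * N * K)) * x1
        + ∑ j ∈ Icc 2 (K - L), ∑ i ∈ Icc (j - 1) (K - L - 1),
            (((K : ℝ) - L - i) * ((K : ℝ) - L + 1 - i) / (2 * N * K)) * x (i, j)) :
    R ≥ (K : ℝ) - ((K : ℝ) - ((K : ℝ) - L) * ((K : ℝ) - L + 1) / (2 * K)) * (M * K / N) := by
  have hKr : (0 : ℝ) < K := by exact_mod_cast hK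
  have hNr : (0 : ℝ) < N := by exact_mod_cast hN
  have hLr : (1 : ℝ) ≤ L := by exact_mod_cast hL
  have hLKr : (L : ℝ) < K := by exact_mod_cast hLK
  have hK2Lr : (K : ℝ) ≤ 2 * L := by exact_mod_cast hK2L
  have hxsum : 2 * (∑ j ∈ Icc 2 (K - L), ∑ i ∈ Icc (j - 1) (K - L - 1), x (i, j))
      ≤ ∑ j ∈ Icc 2 (K - L), ∑ i ∈ Icc (j - 1) (K - L - 1), (j : ℝ) * x (i, j) := by
    simp only [mul_sum]
    refine sum_le_sum fun j hj => sum_le_sum fun i hi => ?_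
    rw [mem_Icc] at hj hi
    exact mul_le_mul_of_nonneg_right (by exact_mod_cast hj.1) (hx j i hj.1 hj.2 hi.1 hi.2)
  have hysum : 2 * (∑ j ∈ Icc 2 K, y j) ≤ ∑ j ∈ Icc 2 K, (j : ℝ) * y j := by
    rw [mul_sum]
    refine sum_le_sum fun j hj => ?_
    rw [mem_Icc] at hj
    exact mul_le_mul_of_nonneg_right (by exact_mod_cast hj.1) (hy j hj.1 hj.2)
  have hrate : 0 ≤ ∑ j ∈ Icc 2 (K - L), ∑ i ∈ Icc (j - 1) (K - L - 1),
      (((K : ℝ) - L - i) * ((K : ℝ) - L + 1 - i) / (2 * N * K)) * x (i, j) := by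
    refine sum_nonneg fun j hj => sum_nonneg fun i hi => ?_
    rw [mem_Icc] at hj hi
    have hi' : (i : ℝ) + L ≤ K := by
      have : i + L ≤ K := by omega
      exact_mod_cast this
    refine mul_nonneg (div_nonneg (mul_nonneg ?_ ?_) (by positivity))
      (hx j i hj.1 hj.2 hi.1 hi.2) <;> linarith
  have hXY : 0 ≤ (∑ j ∈ Icc 2 (K - L), ∑ i ∈ Icc (j - 1) (K - L - 1), x (i, j))
      + ∑ j ∈ Icc 2 K, y j := by
    refine add_nonneg (sum_nonneg fun j hj => sum_nonneg fun i hi => ?_)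
      (sum_nonneg fun j hj => ?_)
    · rw [mem_Icc] at hj hi
      exact hx j i hj.1 hj.2 hi.1 hi.2
    · rw [mem_Icc] at hj
      exact hy j hj.1 hj.2
  generalize (∑ j ∈ Icc 2 (K - L), ∑ i ∈ Icc (j - 1) (K - L - 1),
      (((K : ℝ) - L - i) * ((K : ℝ) - L + 1 - i) / (2 * N * K)) * x (i, j)) = S at *
  generalize (∑ j ∈ Icc 2 (K - L), ∑ i ∈ Icc (j - 1) (K - L - 1), (j : ℝ) * x (i, j)) = X' at *
  generalize (∑ j ∈ Icc 2 (K - L), ∑ i ∈ Icc (j - 1) (K - L - 1), x (i, j)) = X at *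
  generalize (∑ j ∈ Icc 2 K, (j : ℝ) * y j) = Y' at *
  generalize (∑ j ∈ Icc 2 K, y j) = Y at *
  have hcoeff : ((K : ℝ) - L) * ((K : ℝ) - L + 1) / (2 * N * K)
      = ((K : ℝ) - L) * ((K : ℝ) - L + 1) / (2 * K) / N := by
    field_simp
  have hA : 2 * (((K : ℝ) - L) * ((K : ℝ) - L + 1) / (2 * K)) ≤ K := by
    rw [← mul_div_assoc, div_le_iff₀ (by positivity)]
    nlinarith [mul_le_mul (show (K : ℝ) - L ≤ K by linarith)
      (show (K : ℝ) - L + 1 ≤ K by linarith) (by linarith) hKr.le]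
  rw [hcoeff] at h3
  generalize ((K : ℝ) - L) * ((K : ℝ) - L + 1) / (2 * K) = A at *
  have hkey : K * N - (K - A) * (M * K) ≤ K * x0 + A * x1 := by
    have hcap : x1 + 2 * (X + Y) ≤ K * M := by linarith
    have hmul := mul_le_mul_of_nonneg_left hcap (show 0 ≤ K - A by linarith)
    have hslack := mul_nonneg (sub_nonneg.2 hA) hXY
    rw [← h1]
    linarith
  calc (K : ℝ) - (K - A) * (M * K / N) = (K * N - (K - A) * (M * K)) / N := by field_simp
    _ ≤ (K * x0 + A * x1) / N := by gcongr
    _ = K / N * x0 + A / N * x1 := by ring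
    _ ≤ R := by linarith
end

section
/- Let K, L, N be positive integers with K ≤ 2L and L < K, and let M ≥ 0 and R be real numbers. Suppose x₀ ≥ 0 and x₁ ≥ 0 are real, x : ℕ × ℕ → ℝ satisfies x(i,j) ≥ 0 for all integers j, i with 2 ≤ j ≤ K−L and j−1 ≤ i ≤ K−L−1, and y : ℕ → ℝ satisfies y(j) ≥ 0 for all 2 ≤ j ≤ K. Assume: (i) x₀ + x₁ + Σ_{j=2}^{K−L} Σ_{i=j−1}^{K−L−1} x(i,j) + Σ_{j=2}^{K} y(j) = N; (ii) x₁ + Σ_{j=2}^{K−L} Σ_{i=j−1}^{K−L−1} j·x(i,j) + Σ_{j=2}^{K} j·y(j) ≤ K·M; (iii) R ≥ (K/N)·x₀ + ((K−L)(K−L+1)/(2NK))·x₁ + Σ_{j=2}^{K−L} Σ_{i=j−1}^{K−L−1} ((K−L−i)(K−L+1−i)/(2NK))·x(i,j). Then R ≥ ((K−L)(K−L+1)/(2K))·(2 − MK/N). -/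
open Finset

/-- Converse bound (second regime) for the `(N,K,L)`-CCDN with `K/2 ≤ L < K`:
any uncoded placement satisfying the file-size, cache-capacity, and
index-coding cut-set constraints has rate
`R ≥ ((K−L)(K−L+1)/(2K))·(2 − MK/N)`. -/
theorem ccdn_lower_bound_second_regime
    (K L N : ℕ) (hK : 0 < K) (hL : 0 < L) (hN : 0 < N)
    (hK2L : K ≤ 2 * L) (hLK : L < K)
    (M R : ℝ) (hM : 0 ≤ M)
    (x0 x1 : ℝ) (hx0 : 0 ≤ x0) (hx1 : 0 ≤ x1)
    (x : ℕ × ℕ → ℝ)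
    (hx : ∀ j i : ℕ, 2 ≤ j → j ≤ K - L → j - 1 ≤ i → i ≤ K - L - 1 → 0 ≤ x (i, j))
    (y : ℕ → ℝ) (hy : ∀ j : ℕ, 2 ≤ j → j ≤ K → 0 ≤ y j)
    (h1 : x0 + x1
        + (∑ j ∈ Icc 2 (K - L), ∑ i ∈ Icc (j - 1) (K - L - 1), x (i, j))
        + (∑ j ∈ Icc 2 K, y j) = (N : ℝ))
    (h2 : x1
        + (∑ j ∈ Icc 2 (K - L), ∑ i ∈ Icc (j - 1) (K - L - 1), (j : ℝ) * x (i, j))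
        + (∑ j ∈ Icc 2 K, (j : ℝ) * y j) ≤ (K : ℝ) * M)
    (h3 : R ≥ ((K : ℝ) / N) * x0
        + (((K : ℝ) - L) * ((K : ℝ) - L + 1) / (2 * N * K)) * x1
        + ∑ j ∈ Icc 2 (K - L), ∑ i ∈ Icc (j - 1) (K - L - 1),
            (((K : ℝ) - L - i) * ((K : ℝ) - L + 1 - i) / (2 * N * K)) * x (i, j)) :
    R ≥ (((K : ℝ) - L) * ((K : ℝ) - L + 1) / (2 * K)) * (2 - M * K / N) := by
  have hK' : (0 : ℝ) < K := by exact_mod_cast hK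
  have hN' : (0 : ℝ) < N := by exact_mod_cast hN
  have hL' : (1 : ℝ) ≤ L := by exact_mod_cast hL
  have hLK' : (L : ℝ) + 1 ≤ K := by exact_mod_cast hLK
  have hxs : 2 * (∑ j ∈ Icc 2 (K - L), ∑ i ∈ Icc (j - 1) (K - L - 1), x (i, j))
      ≤ ∑ j ∈ Icc 2 (K - L), ∑ i ∈ Icc (j - 1) (K - L - 1), (j : ℝ) * x (i, j) := by
    simp only [mul_sum]
    refine sum_le_sum fun j hj => sum_le_sum fun i hi => ?_
    rw [mem_Icc] at hj hi
    exact mul_le_mul_of_nonneg_right (by exact_mod_cast hj.1) (hx j i hj.1 hj.2 hi.1 hi.2)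
  have hys : 2 * (∑ j ∈ Icc 2 K, y j) ≤ ∑ j ∈ Icc 2 K, (j : ℝ) * y j := by
    rw [mul_sum]
    refine sum_le_sum fun j hj => ?_
    rw [mem_Icc] at hj
    exact mul_le_mul_of_nonneg_right (by exact_mod_cast hj.1) (hy j hj.1 hj.2)
  have hcut : 0 ≤ ∑ j ∈ Icc 2 (K - L), ∑ i ∈ Icc (j - 1) (K - L - 1),
      (((K : ℝ) - L - i) * ((K : ℝ) - L + 1 - i) / (2 * N * K)) * x (i, j) := by
    refine sum_nonneg fun j hj => sum_nonneg fun i hi => ?_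
    rw [mem_Icc] at hj hi
    have hi' : (i : ℝ) + L ≤ K := by
      have : i + L ≤ K := by omega
      exact_mod_cast this
    exact mul_nonneg
      (div_nonneg (mul_nonneg (by linarith) (by linarith)) (by positivity))
      (hx j i hj.1 hj.2 hi.1 hi.2)
  have hmem : 2 * (N : ℝ) - M * K ≤ 2 * x0 + x1 := by linarith
  have hsq : ((K : ℝ) - L) * ((K : ℝ) - L + 1) ≤ K * K :=
    mul_le_mul (by linarith) (by linarith) (by linarith) hK'.le
  have hcoef : 0 ≤ ((K : ℝ) - L) * ((K : ℝ) - L + 1) / (2 * N * K) :=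
    div_nonneg (mul_nonneg (by linarith) (by linarith)) (by positivity)
  have hcoef' : 2 * (((K : ℝ) - L) * ((K : ℝ) - L + 1) / (2 * N * K)) ≤ K / N := by
    rw [show 2 * (((K : ℝ) - L) * ((K : ℝ) - L + 1) / (2 * N * K))
      = ((K : ℝ) - L) * ((K : ℝ) - L + 1) / (N * K) by field_simp,
      div_le_div_iff₀ (by positivity) hN']
    nlinarith [mul_le_mul_of_nonneg_right hsq hN'.le]
  have hgoal : (((K : ℝ) - L) * ((K : ℝ) - L + 1) / (2 * K)) * (2 - M * K / N)
      = ((K : ℝ) - L) * ((K : ℝ) - L + 1) / (2 * N * K) * (2 * N - M * K) := by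
    field_simp
  rw [hgoal]
  have hbound := mul_le_mul_of_nonneg_left hmem hcoef
  have hx0' := mul_le_mul_of_nonneg_right hcoef' hx0
  linarith
end

section
/- Let K, L, i be positive integers with i·L ≤ K, and let Ŝ be the collection of i-element subsets of ZMod K in which any two distinct elements are at cyclic distance at least L. Then i · |Ŝ| = K · C(K − iL + i − 1, i − 1), where C denotes the binomial coefficient; equivalently, |Ŝ| = C(K − iL + i − 1, i − 1) · K / i. -/
/-- `Shat K L i` is the collection of `i`-element subsets of `ZMod K` in which any two
distinct elements are at cyclic distance at least `L`. -/
def Shat (K : ℕ) [NeZero K] (L i : ℕ) : Finset (Finset (ZMod K)) :=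
  Finset.univ.filter (fun s : Finset (ZMod K) =>
    s.card = i ∧ ∀ a ∈ s, ∀ b ∈ s, a ≠ b → L ≤ (a - b).val ∧ L ≤ K - (a - b).val)

/-- The `m`-element subsets of `{0, …, n - 1}` in which any two distinct elements differ by more
than `d`. -/
def gapSets (d n m : ℕ) : Finset (Finset ℕ) :=
  ((Finset.range n).powersetCard m).filter fun t => ∀ x ∈ t, ∀ y ∈ t, x < y → x + d < y

theorem mem_gapSets {d n m : ℕ} {t : Finset ℕ} :
    t ∈ gapSets d n m ↔
      ((∀ x ∈ t, x < n) ∧ t.card = m) ∧ ∀ x ∈ t, ∀ y ∈ t, x < y → x + d < y := by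
  simp [gapSets, Finset.mem_powersetCard, Finset.subset_iff]

theorem card_gapSets_zero_right (d n : ℕ) : (gapSets d n 0).card = 1 := by
  rw [Finset.card_eq_one]
  refine ⟨∅, ?_⟩
  ext t
  rw [mem_gapSets, Finset.mem_singleton]
  constructor
  · rintro ⟨⟨-, h⟩, -⟩
    exact Finset.card_eq_zero.mp h
  · rintro rfl
    simp

theorem card_gapSets_zero_succ (d m : ℕ) : (gapSets d 0 (m + 1)).card = 0 := by
  simp [gapSets]

theorem card_gapSets_succ_succ (d n m : ℕ) :
    (gapSets d (n + 1) (m + 1)).card =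
      (gapSets d n (m + 1)).card + (gapSets d (n - d) m).card := by
  rw [← Finset.card_filter_add_card_filter_not (s := gapSets d (n + 1) (m + 1)) (n ∉ ·)]
  congr 1
  · congr 1
    ext t
    simp only [Finset.mem_filter, mem_gapSets]
    constructor
    · rintro ⟨⟨⟨h1, h2⟩, h3⟩, h4⟩
      refine ⟨⟨fun x hx => ?_, h2⟩, h3⟩
      have := h1 x hx
      have : x ≠ n := fun h => h4 (h ▸ hx)
      omega
    · rintro ⟨⟨h1, h2⟩, h3⟩
      exact ⟨⟨⟨fun x hx => (h1 x hx).trans n.lt_succ_self, h2⟩, h3⟩,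
        fun h => (h1 n h).false⟩
  · refine Finset.card_nbij' (fun t => t.erase n) (fun t => insert n t) ?_ ?_ ?_ ?_
    · intro t ht
      simp only [Finset.mem_coe, Finset.mem_filter, mem_gapSets, not_not] at ht ⊢
      obtain ⟨⟨⟨h1, h2⟩, h3⟩, h4⟩ := ht
      refine ⟨⟨fun x hx => ?_, ?_⟩, fun x hx y hy => ?_⟩
      · obtain ⟨hne, hx⟩ := Finset.mem_erase.mp hx
        have := h1 x hx
        have := h3 x hx n h4 (by omega)
        omega
      · rw [Finset.card_erase_of_mem h4, h2, Nat.add_sub_cancel]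
      · exact h3 x (Finset.mem_of_mem_erase hx) y (Finset.mem_of_mem_erase hy)
    · intro t ht
      simp only [Finset.mem_coe, Finset.mem_filter, mem_gapSets, not_not] at ht ⊢
      obtain ⟨⟨h1, h2⟩, h3⟩ := ht
      have hn : n ∉ t := fun h => by have := h1 n h; omega
      refine ⟨⟨⟨fun x hx => ?_, ?_⟩, fun x hx y hy hxy => ?_⟩, Finset.mem_insert_self _ _⟩
      · rcases Finset.mem_insert.mp hx with rfl | hx
        · omega
        · have := h1 x hx; omega
      · rw [Finset.card_insert_of_notMem hn, h2]
      · rcases Finset.mem_insert.mp hx with rfl | hxt <;>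
          rcases Finset.mem_insert.mp hy with rfl | hyt
        · omega
        · have := h1 y hyt; omega
        · have := h1 x hxt; omega
        · exact h3 x hxt y hyt hxy
    · intro t ht
      simp only [Finset.mem_coe, Finset.mem_filter, not_not] at ht
      exact Finset.insert_erase ht.2
    · intro t ht
      simp only [Finset.mem_coe, mem_gapSets] at ht
      exact Finset.erase_insert fun h => by have := ht.1.1 n h; omega

theorem card_gapSets (d n m : ℕ) : (gapSets d n m).card = (n + d - m * d).choose m := by
  induction n using Nat.strong_induction_on generalizing m with
  | _ n ih =>
    rcases m with _ | m
    · simp [card_gapSets_zero_right]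
    rcases n with _ | n
    · rw [card_gapSets_zero_succ, Nat.choose_eq_zero_of_lt]
      rw [Nat.succ_mul]
      omega
    rw [card_gapSets_succ_succ, ih n n.lt_succ_self, ih (n - d) (by omega), Nat.succ_mul]
    rcases m with _ | m
    · simp
    rw [Nat.succ_mul]
    by_cases h : m * d + d ≤ n
    · rw [show n + 1 + d - (m * d + d + d) = (n - (m * d + d)) + 1 by omega,
        show n + d - (m * d + d + d) = n - (m * d + d) by omega,
        show n - d + d - (m * d + d) = n - (m * d + d) by omega,
        Nat.choose_succ_succ', Nat.add_comm]
    · rw [show n + 1 + d - (m * d + d + d) = 0 by omega,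
        show n + d - (m * d + d + d) = 0 by omega,
        show n - d + d - (m * d + d) = 0 by omega]
      simp

theorem mem_Shat {K : ℕ} [NeZero K] {L i : ℕ} {s : Finset (ZMod K)} :
    s ∈ Shat K L i ↔ s.card = i ∧
      ∀ a ∈ s, ∀ b ∈ s, a ≠ b → L ≤ (a - b).val ∧ L ≤ K - (a - b).val := by
  simp [Shat]

theorem map_addRight_mem_Shat {K : ℕ} [NeZero K] {L i : ℕ} {s : Finset (ZMod K)}
    (hs : s ∈ Shat K L i) (c : ZMod K) :
    s.map (Equiv.addRight c).toEmbedding ∈ Shat K L i := by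
  rw [mem_Shat] at hs ⊢
  refine ⟨by rw [Finset.card_map, hs.1], fun a ha b hb hab => ?_⟩
  obtain ⟨a, has, rfl⟩ := Finset.mem_map.mp ha
  obtain ⟨b, hbs, rfl⟩ := Finset.mem_map.mp hb
  have := hs.2 a has b hbs (fun h => hab (h ▸ rfl))
  simpa using this

theorem card_filter_mem_Shat (K : ℕ) [NeZero K] (L i : ℕ) (a : ZMod K) :
    ((Shat K L i).filter (a ∈ ·)).card = ((Shat K L i).filter (0 ∈ ·)).card := by
  refine Finset.card_nbij' (fun s => s.map (Equiv.addRight (-a)).toEmbedding)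
    (fun s => s.map (Equiv.addRight a).toEmbedding) ?_ ?_ ?_ ?_
  · intro s hs
    simp only [Finset.mem_coe, Finset.mem_filter] at hs ⊢
    exact ⟨map_addRight_mem_Shat hs.1 _, Finset.mem_map.mpr ⟨a, hs.2, by simp⟩⟩
  · intro s hs
    simp only [Finset.mem_coe, Finset.mem_filter] at hs ⊢
    exact ⟨map_addRight_mem_Shat hs.1 _, Finset.mem_map.mpr ⟨0, hs.2, by simp⟩⟩
  · intro s _
    ext x
    simp
  · intro s _
    ext x
    simp

theorem ZMod.cyclic_dist_iff_of_val_lt {K : ℕ} [NeZero K] {L : ℕ} {a b : ZMod K}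
    (h : a.val < b.val) :
    ((L ≤ (a - b).val ∧ L ≤ K - (a - b).val) ↔ a.val + L ≤ b.val ∧ b.val + L ≤ K + a.val) ∧
    ((L ≤ (b - a).val ∧ L ≤ K - (b - a).val) ↔
      a.val + L ≤ b.val ∧ b.val + L ≤ K + a.val) := by
  have hb := ZMod.val_lt b
  have h1 : (b - a).val = b.val - a.val := ZMod.val_sub h.le
  have h2 : (a - b).val = K - (b.val - a.val) := by
    rw [← neg_sub b a, ZMod.neg_val, if_neg, h1]
    intro h0
    rw [h0, ZMod.val_zero] at h1
    omega
  rw [h1, h2]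
  omega

theorem mem_Shat_iff_val {K : ℕ} [NeZero K] {L i : ℕ} {s : Finset (ZMod K)} :
    s ∈ Shat K L i ↔ s.card = i ∧ ∀ a ∈ s, ∀ b ∈ s, a.val < b.val →
      a.val + L ≤ b.val ∧ b.val + L ≤ K + a.val := by
  rw [mem_Shat]
  refine and_congr_right fun _ => ⟨fun h a ha b hb hab => ?_, fun h a ha b hb hab => ?_⟩
  · exact (ZMod.cyclic_dist_iff_of_val_lt hab).1.mp
      (h a ha b hb (fun h => hab.ne (congrArg ZMod.val h)))
  · rcases lt_or_gt_of_ne ((ZMod.val_injective K).ne hab) with hlt | hlt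
    · exact (ZMod.cyclic_dist_iff_of_val_lt hlt).1.mpr (h a ha b hb hlt)
    · exact (ZMod.cyclic_dist_iff_of_val_lt hlt).2.mpr (h b hb a ha hlt)

theorem card_filter_zero_mem_Shat (K : ℕ) [NeZero K] (d j : ℕ) :
    ((Shat K (d + 1) (j + 1)).filter (0 ∈ ·)).card =
      (gapSets d (K + 1 - 2 * (d + 1)) j).card := by
  have val_shift : ∀ {t : Finset ℕ}, t ∈ gapSets d (K + 1 - 2 * (d + 1)) j → ∀ x ∈ t,
      ((x + (d + 1) : ℕ) : ZMod K).val = x + (d + 1) := fun ht x hx => by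
    have := (mem_gapSets.mp ht).1.1 x hx
    exact ZMod.val_cast_of_lt (by omega)
  have val_bounds : ∀ {s : Finset (ZMod K)}, s ∈ (Shat K (d + 1) (j + 1)).filter (0 ∈ ·) →
      ∀ a ∈ s.erase 0, d + 1 ≤ a.val ∧ a.val + (d + 1) ≤ K := fun hs a ha => by
    rw [Finset.mem_filter, mem_Shat_iff_val] at hs
    obtain ⟨ha0, ha⟩ := Finset.mem_erase.mp ha
    have := hs.1.2 0 hs.2 a ha (by rw [ZMod.val_zero]; exact ZMod.val_pos.mpr ha0)
    simpa using this
  refine Finset.card_nbij' (fun s => (s.erase 0).image fun a => a.val - (d + 1))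
    (fun t => insert 0 (t.image fun x => ((x + (d + 1) : ℕ) : ZMod K))) ?_ ?_ ?_ ?_
  · intro s hs
    have hb := val_bounds hs
    rw [Finset.mem_coe, Finset.mem_filter, mem_Shat_iff_val] at hs
    obtain ⟨⟨h1, h2⟩, h3⟩ := hs
    rw [Finset.mem_coe, mem_gapSets]
    refine ⟨⟨fun x hx => ?_, ?_⟩, fun x hx y hy hxy => ?_⟩
    · obtain ⟨a, ha, rfl⟩ := Finset.mem_image.mp hx
      have := hb a ha
      omega
    · rw [Finset.card_image_of_injOn, Finset.card_erase_of_mem h3, h1, Nat.add_sub_cancel]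
      intro a ha b hb' hab
      have := hb a ha
      have := hb b hb'
      refine ZMod.val_injective K ?_
      simp only at hab
      omega
    · obtain ⟨a, ha, rfl⟩ := Finset.mem_image.mp hx
      obtain ⟨b, hb', rfl⟩ := Finset.mem_image.mp hy
      have := hb a ha
      have := hb b hb'
      have := h2 a (Finset.mem_of_mem_erase ha) b (Finset.mem_of_mem_erase hb') (by omega)
      omega
  · intro t ht
    have hv := val_shift ht
    rw [Finset.mem_coe, mem_gapSets] at ht
    obtain ⟨⟨h1, h2⟩, h3⟩ := ht
    rw [Finset.mem_coe, Finset.mem_filter, mem_Shat_iff_val]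
    refine ⟨⟨?_, fun a ha b hb hab => ?_⟩, Finset.mem_insert_self _ _⟩
    · rw [Finset.card_insert_of_notMem, Finset.card_image_of_injOn, h2]
      · intro x hx y hy hxy
        have := congrArg ZMod.val hxy
        simp only [hv x hx, hv y hy] at this
        omega
      · intro h
        obtain ⟨x, hx, h0⟩ := Finset.mem_image.mp h
        have := hv x hx
        rw [h0, ZMod.val_zero] at this
        omega
    · rcases Finset.mem_insert.mp ha with rfl | ha <;>
        rcases Finset.mem_insert.mp hb with rfl | hb
      · exact absurd hab (lt_irrefl _)
      · obtain ⟨y, hy, rfl⟩ := Finset.mem_image.mp hb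
        have := h1 y hy
        rw [hv y hy, ZMod.val_zero]
        omega
      · simp at hab
      · obtain ⟨x, hx, rfl⟩ := Finset.mem_image.mp ha
        obtain ⟨y, hy, rfl⟩ := Finset.mem_image.mp hb
        rw [hv x hx, hv y hy] at hab ⊢
        have := h3 x hx y hy (by omega)
        have := h1 y hy
        omega
  · intro s hs
    have hb := val_bounds hs
    rw [Finset.mem_coe, Finset.mem_filter] at hs
    simp only [Finset.image_image]
    rw [Finset.image_congr (g := id), Finset.image_id, Finset.insert_erase hs.2]
    intro a ha
    simp only [Function.comp_apply, id_eq]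
    rw [Nat.sub_add_cancel (hb a ha).1, ZMod.natCast_zmod_val]
  · intro t ht
    have hv := val_shift ht
    simp only
    rw [Finset.erase_insert, Finset.image_image, Finset.image_congr (g := id), Finset.image_id]
    · intro x hx
      simp only [Function.comp_apply, id_eq]
      rw [hv x hx, Nat.add_sub_cancel]
    · intro h
      obtain ⟨x, hx, h0⟩ := Finset.mem_image.mp h
      have := hv x hx
      rw [h0, ZMod.val_zero] at this
      omega

/-- The number of subfiles in the placement at memory `M = iN/K`:
`|Ŝ| = C(K − iL + i − 1, i − 1) · K / i`. -/
theorem card_Shat (K : ℕ) [NeZero K] (L i : ℕ) (hL : 0 < L) (hi : 0 < i)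
    (hiL : i * L ≤ K) :
    i * (Shat K L i).card = K * Nat.choose (K - i * L + i - 1) (i - 1) := by
  have double_count := Finset.sum_card (card_filter_mem_Shat K L i)
  rw [Finset.sum_congr rfl fun s hs => (mem_Shat.mp hs).1, Finset.sum_const, smul_eq_mul,
    ZMod.card, Nat.mul_comm] at double_count
  rw [double_count]
  obtain ⟨d, rfl⟩ := Nat.exists_eq_add_of_lt hL
  obtain ⟨j, rfl⟩ := Nat.exists_eq_add_of_lt hi
  simp only [Nat.zero_add] at *
  rw [card_filter_zero_mem_Shat, card_gapSets, Nat.add_sub_cancel]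
  rcases j with _ | j
  · simp
  · congr 2
    have h : (j + 1 + 1) * (d + 1) = j * d + j + 2 * d + 2 := by ring
    rw [Nat.succ_mul j d]
    omega
end

section
/- Let K, L, i be positive integers with i·L ≤ K, and let Ŝ be the collection of i-element subsets of ZMod K in which any two distinct elements are at cyclic distance at least L. Then for every a ∈ ZMod K, the number of sets s ∈ Ŝ with a ∈ s equals C(K − iL + i − 1, i − 1). -/
/-- The `k`-element subsets of `{L, …, m - L}` in which distinct elements differ by at least `L`. -/
def spacedSubsets (L k m : ℕ) : Finset (Finset ℕ) :=
  ((Finset.range (m + 1)).powersetCard k).filter (fun t =>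
    (∀ x ∈ t, L ≤ x ∧ x + L ≤ m) ∧ ∀ x ∈ t, ∀ y ∈ t, x < y → x + L ≤ y)

theorem mem_spacedSubsets {L k m : ℕ} {t : Finset ℕ} :
    t ∈ spacedSubsets L k m ↔ t.card = k ∧ (∀ x ∈ t, L ≤ x ∧ x + L ≤ m) ∧
      ∀ x ∈ t, ∀ y ∈ t, x < y → x + L ≤ y := by
  simp only [spacedSubsets, Finset.mem_filter, Finset.mem_powersetCard]
  constructor
  · rintro ⟨⟨_, h⟩, h'⟩
    exact ⟨h, h'⟩
  · rintro ⟨h, h'⟩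
    refine ⟨⟨fun x hx => ?_, h⟩, h'⟩
    have := h'.1 x hx
    rw [Finset.mem_range]
    omega

theorem spacedSubsets_zero (L m : ℕ) : spacedSubsets L 0 m = {∅} := by
  ext t
  rw [mem_spacedSubsets, Finset.mem_singleton, Finset.card_eq_zero]
  constructor
  · exact fun h => h.1
  · rintro rfl
    simp

theorem spacedSubsets_succ_of_lt {L k m : ℕ} (h : m < 2 * L) :
    spacedSubsets L (k + 1) m = ∅ := by
  refine Finset.eq_empty_of_forall_notMem fun t ht => ?_
  rw [mem_spacedSubsets] at ht
  obtain ⟨x, hx⟩ : t.Nonempty := Finset.card_pos.1 (by omega)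
  have := ht.2.1 x hx
  omega

theorem spacedSubsets_succ {L k m : ℕ} (hL : 0 < L) (h : 2 * L ≤ m) :
    (spacedSubsets L (k + 1) m).card =
      (spacedSubsets L k (m - L)).card + (spacedSubsets L (k + 1) (m - 1)).card := by
  rw [← Finset.card_filter_add_card_filter_not (fun t => m - L ∈ t)]
  congr 1
  · refine Finset.card_nbij' (fun t => t.erase (m - L)) (fun t => insert (m - L) t) ?_ ?_ ?_ ?_
    · intro t ht
      simp only [Finset.mem_coe, Finset.mem_filter, mem_spacedSubsets] at ht ⊢
      obtain ⟨⟨hc, hb, hg⟩, hm⟩ := ht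
      refine ⟨by rw [Finset.card_erase_of_mem hm, hc]; rfl, fun x hx => ?_, fun x hx y hy => ?_⟩
      · have hx' := Finset.mem_erase.1 hx
        have h1 := hb x hx'.2
        exact ⟨h1.1, hg x hx'.2 _ hm (by omega)⟩
      · exact hg x (Finset.mem_of_mem_erase hx) y (Finset.mem_of_mem_erase hy)
    · intro t ht
      simp only [Finset.mem_coe, Finset.mem_filter, mem_spacedSubsets] at ht ⊢
      obtain ⟨hc, hb, hg⟩ := ht
      have hn : m - L ∉ t := fun hx => by
        have := hb _ hx
        omega
      refine ⟨⟨by rw [Finset.card_insert_of_notMem hn, hc], fun x hx => ?_, fun x hx y hy hxy => ?_⟩,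
        Finset.mem_insert_self _ _⟩
      · rcases Finset.mem_insert.1 hx with rfl | hx
        · omega
        · have := hb x hx
          omega
      · rcases Finset.mem_insert.1 hx with rfl | hx <;> rcases Finset.mem_insert.1 hy with rfl | hy
        · omega
        · have := hb y hy
          omega
        · exact (hb x hx).2
        · exact hg x hx y hy hxy
    · intro t ht
      exact Finset.insert_erase (Finset.mem_filter.1 (Finset.mem_coe.1 ht)).2
    · intro t ht
      refine Finset.erase_insert fun hx => ?_
      have := (mem_spacedSubsets.1 (Finset.mem_coe.1 ht)).2.1 _ hx
      omega
  · congr 1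
    ext t
    simp only [Finset.mem_filter, mem_spacedSubsets]
    constructor
    · rintro ⟨⟨hc, hb, hg⟩, hm⟩
      refine ⟨hc, fun x hx => ?_, hg⟩
      have := hb x hx
      have : x ≠ m - L := fun e => hm (e ▸ hx)
      omega
    · rintro ⟨hc, hb, hg⟩
      refine ⟨⟨hc, fun x hx => ?_, hg⟩, fun hx => ?_⟩
      · have := hb x hx
        omega
      · have := hb _ hx
        omega

theorem card_spacedSubsets {L : ℕ} (hL : 0 < L) (k m : ℕ) :
    (spacedSubsets L k m).card = Nat.choose (m + k - (k + 1) * L) k := by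
  induction m using Nat.strong_induction_on generalizing k with
  | _ m ih =>
    rcases k with _ | k
    · simp [spacedSubsets_zero]
    · rcases lt_or_ge m (2 * L) with h | h
      · rw [spacedSubsets_succ_of_lt h, Finset.card_empty, Nat.choose_eq_zero_of_lt]
        have : (k + 1 + 1) * L = k * L + 2 * L := by ring
        omega
      · rw [spacedSubsets_succ hL h, ih (m - L) (by omega), ih (m - 1) (by omega)]
        have e1 : (k + 1 + 1) * L = k * L + 2 * L := by ring
        have e2 : (k + 1) * L = k * L + L := by ring
        rw [e1, e2]
        rcases le_or_gt (k * L + 2 * L) (m + k) with h' | h'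
        · rw [show m + (k + 1) - (k * L + 2 * L) = (m + k - (k * L + 2 * L)) + 1 by omega,
            show m - L + k - (k * L + L) = m + k - (k * L + 2 * L) by omega,
            show m - 1 + (k + 1) - (k * L + 2 * L) = m + k - (k * L + 2 * L) by omega,
            Nat.choose_succ_succ]
        · have hk : 0 < k := by
            rcases Nat.eq_zero_or_pos k with rfl | hk
            · omega
            · exact hk
          rw [Nat.choose_eq_zero_of_lt, Nat.choose_eq_zero_of_lt, Nat.choose_eq_zero_of_lt] <;>
            omega

theorem cyclic_dist_iff {K : ℕ} [NeZero K] {L : ℕ} {a x y : ZMod K}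
    (h : (x - a).val < (y - a).val) :
    (L ≤ (y - x).val ∧ L ≤ K - (y - x).val ↔
      (x - a).val + L ≤ (y - a).val ∧ (y - a).val + L ≤ K + (x - a).val) ∧
    (L ≤ (x - y).val ∧ L ≤ K - (x - y).val ↔
      (x - a).val + L ≤ (y - a).val ∧ (y - a).val + L ≤ K + (x - a).val) := by
  have h1 : (y - x).val = (y - a).val - (x - a).val := by
    rw [← ZMod.val_sub h.le, sub_sub_sub_cancel_right]
  have h2 : (x - y).val = K - (y - x).val := by
    rw [← neg_sub y x, ZMod.neg_val, if_neg]
    intro h0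
    rw [h0, ZMod.val_zero] at h1
    omega
  have := ZMod.val_lt (y - a)
  rw [h2, h1]
  omega

theorem card_Shat_mem_eq_card_spacedSubsets (K : ℕ) [NeZero K] {L : ℕ} (hL : 0 < L) (k : ℕ)
    (a : ZMod K) :
    ((Shat K L (k + 1)).filter (fun s => a ∈ s)).card = (spacedSubsets L k K).card := by
  have hinj : Function.Injective fun x : ZMod K => (x - a).val := fun x y h =>
    sub_left_injective (ZMod.val_injective K h)
  have hval : ∀ n : ℕ, n < K → (a + (n : ZMod K) - a).val = n := fun n hn => by
    rw [add_sub_cancel_left, ZMod.val_cast_of_lt hn]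
  refine Finset.card_nbij' (fun s => (s.erase a).image fun x => (x - a).val)
    (fun t => insert a (t.image fun n : ℕ => a + (n : ZMod K))) ?_ ?_ ?_ ?_
  · intro s hs
    simp only [Finset.mem_coe, Finset.mem_filter, mem_spacedSubsets, Shat, Finset.mem_univ,
      true_and, Finset.forall_mem_image] at hs ⊢
    obtain ⟨⟨hc, hd⟩, ha⟩ := hs
    refine ⟨?_, fun x hx => ?_, fun x hx y hy hxy => ?_⟩
    · rw [Finset.card_image_of_injective _ hinj, Finset.card_erase_of_mem ha, hc]
      rfl
    · rw [Finset.mem_erase] at hx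
      have := hd x hx.2 a ha hx.1
      omega
    · have hne : y ≠ x := fun e => by simp [e] at hxy
      exact ((cyclic_dist_iff hxy).1.1
        (hd y (Finset.mem_of_mem_erase hy) x (Finset.mem_of_mem_erase hx) hne)).1
  · intro t ht
    simp only [Finset.mem_coe, Finset.mem_filter, mem_spacedSubsets, Shat, Finset.mem_univ,
      true_and] at ht ⊢
    obtain ⟨hc, hb, hg⟩ := ht
    have hlt : ∀ n ∈ t, n < K := fun n hn => by
      have := hb n hn
      omega
    have hn : a ∉ t.image fun n : ℕ => a + (n : ZMod K) := fun h => by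
      obtain ⟨n, hn, h⟩ := Finset.mem_image.1 h
      have h1 := hval n (hlt n hn)
      rw [h, sub_self, ZMod.val_zero] at h1
      have := hb n hn
      omega
    have hpos : ∀ x ∈ insert a (t.image fun n : ℕ => a + (n : ZMod K)),
        (x - a).val = 0 ∨ (x - a).val ∈ t := fun x hx => by
      rcases Finset.mem_insert.1 hx with rfl | hx
      · simp
      · obtain ⟨n, hn, rfl⟩ := Finset.mem_image.1 hx
        rw [hval n (hlt n hn)]
        exact Or.inr hn
    have hsep : ∀ x ∈ insert a (t.image fun n : ℕ => a + (n : ZMod K)),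
        ∀ y ∈ insert a (t.image fun n : ℕ => a + (n : ZMod K)), (x - a).val < (y - a).val →
        (x - a).val + L ≤ (y - a).val ∧ (y - a).val + L ≤ K + (x - a).val := by
      intro x hx y hy hxy
      rcases hpos y hy with hy | hy
      · omega
      · have h1 := hb _ hy
        rcases hpos x hx with hx | hx
        · omega
        · have := hg _ hx _ hy hxy
          omega
    refine ⟨⟨?_, fun x hx y hy hxy => ?_⟩, Finset.mem_insert_self _ _⟩
    · rw [Finset.card_insert_of_notMem hn, Finset.card_image_of_injOn, hc]
      intro m hm n hn h
      rw [← hval m (hlt m hm), ← hval n (hlt n hn)]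
      exact congrArg (fun z => (z - a).val) h
    · rcases lt_or_gt_of_ne (fun h => hxy (hinj h) : (x - a).val ≠ (y - a).val) with h | h
      · exact (cyclic_dist_iff h).2.2 (hsep x hx y hy h)
      · exact (cyclic_dist_iff h).1.2 (hsep y hy x hx h)
  · intro s hs
    have ha : a ∈ s := (Finset.mem_filter.1 (Finset.mem_coe.1 hs)).2
    simp [Finset.image_image, Function.comp_def, Finset.insert_erase ha]
  · intro t ht
    have hb := (mem_spacedSubsets.1 (Finset.mem_coe.1 ht)).2.1
    have hlt : ∀ n ∈ t, n < K := fun n hn => by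
      have := hb n hn
      omega
    have hn : a ∉ t.image fun n : ℕ => a + (n : ZMod K) := fun h => by
      obtain ⟨n, hn, h⟩ := Finset.mem_image.1 h
      have h1 := hval n (hlt n hn)
      rw [h, sub_self, ZMod.val_zero] at h1
      have := hb n hn
      omega
    simp only [Finset.erase_insert hn, Finset.image_image]
    refine (Finset.image_congr fun n hn => ?_).trans Finset.image_id
    exact hval n (hlt n hn)

/-- Memory constraint of the placement: each cache `a` stores exactly
`C(K − iL + i − 1, i − 1)` of the subfiles in `Ŝ`. -/
theorem card_Shat_mem (K : ℕ) [NeZero K] (L i : ℕ) (hL : 0 < L) (hi : 0 < i)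
    (hiL : i * L ≤ K) (a : ZMod K) :
    ((Shat K L i).filter (fun s => a ∈ s)).card
      = Nat.choose (K - i * L + i - 1) (i - 1) := by
  obtain ⟨k, rfl⟩ : ∃ k, i = k + 1 := ⟨i - 1, by omega⟩
  rw [card_Shat_mem_eq_card_spacedSubsets K hL, card_spacedSubsets hL]
  rw [Nat.add_sub_cancel, show K + k - (k + 1) * L = K - (k + 1) * L + (k + 1) - 1 by omega]
end

section
/- Let K, L, i be positive integers with i·L ≤ K, and let Ŝ be the collection of i-element subsets of ZMod K in which any two distinct elements are at cyclic distance at least L. For a ∈ ZMod K let W(a) = {a − L + 1, a − L + 2, …, a} (mod K), a cyclic window of length L. Then for every s ∈ Ŝ, the windows {W(a) : a ∈ s} are pairwise disjoint; consequently cov(s) := ⋃_{a∈s} W(a) has cardinality exactly i·L. -/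
/-- `W K L a = {a − L + 1, a − L + 2, …, a}` (mod `K`), the cyclic window of length `L`
ending at `a`, i.e. the set of users able to access cache `a`. -/
def W (K : ℕ) [NeZero K] (L : ℕ) (a : ZMod K) : Finset (ZMod K) :=
  (Finset.range L).image (fun j : ℕ => a - (L : ZMod K) + 1 + (j : ZMod K))

theorem card_W (K : ℕ) [NeZero K] {L : ℕ} (hLK : L ≤ K) (a : ZMod K) : (W K L a).card = L := by
  rw [W, Finset.card_image_of_injOn, Finset.card_range]
  intro j hj k hk h
  have hj : j < L := by simpa using hj
  have hk : k < L := by simpa using hk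
  have h : (j : ZMod K) = k := add_left_cancel h
  have hval := congrArg ZMod.val h
  rwa [ZMod.val_cast_of_lt (hj.trans_le hLK), ZMod.val_cast_of_lt (hk.trans_le hLK)] at hval

theorem disjoint_W (K : ℕ) [NeZero K] {L : ℕ} (hLK : L ≤ K) {a b : ZMod K}
    (h₁ : L ≤ (a - b).val) (h₂ : L ≤ K - (a - b).val) : Disjoint (W K L a) (W K L b) := by
  rw [Finset.disjoint_left]
  intro x hxa hxb
  simp only [W, Finset.mem_image, Finset.mem_range] at hxa hxb
  obtain ⟨j, hj, rfl⟩ := hxa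
  obtain ⟨k, hk, h⟩ := hxb
  rcases le_or_gt j k with hjk | hjk
  · have hab : a - b = ((k - j : ℕ) : ZMod K) := by
      rw [Nat.cast_sub hjk]
      linear_combination -h
    rw [hab, ZMod.val_cast_of_lt (by omega)] at h₁
    omega
  · have hab : a - b = ((K - (j - k) : ℕ) : ZMod K) := by
      rw [Nat.cast_sub (by omega), Nat.cast_sub hjk.le, ZMod.natCast_self]
      linear_combination -h
    rw [hab, ZMod.val_cast_of_lt (by omega)] at h₂
    omega

/-- For every `s ∈ Ŝ`, the windows `{W a : a ∈ s}` are pairwise disjoint, and hence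
`cov(s) = ⋃_{a ∈ s} W a` has cardinality exactly `i·L`. -/
theorem windows_disjoint_and_cov_card (K : ℕ) [NeZero K] (L i : ℕ)
    (hL : 0 < L) (hi : 0 < i) (hiL : i * L ≤ K)
    (s : Finset (ZMod K)) (hs : s ∈ Shat K L i) :
    (∀ a ∈ s, ∀ b ∈ s, a ≠ b → Disjoint (W K L a) (W K L b)) ∧
      (s.biUnion (W K L)).card = i * L := by
  obtain ⟨hcard, hdist⟩ := (Finset.mem_filter.mp hs).2
  have hLK : L ≤ K := (Nat.le_mul_of_pos_left L hi).trans hiL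
  have hdisj : ∀ a ∈ s, ∀ b ∈ s, a ≠ b → Disjoint (W K L a) (W K L b) :=
    fun a ha b hb hab => disjoint_W K hLK (hdist a ha b hb hab).1 (hdist a ha b hb hab).2
  refine ⟨hdisj, ?_⟩
  rw [Finset.card_biUnion hdisj, Finset.sum_const_nat fun a _ => card_W K hLK a, hcard]
end

section
/- Let K and L be integers with 1 ≤ L < K. On the node set V = (ZMod K) × Fin (K−L), with Avail(p′, q′) = {p′ + q′ + 1 + j (mod K) : j = 0, …, L−1}, say that a node w interferes with a node v = (p, q) if w ≠ v and p ∉ Avail(w), and let N⁺(v) = {v} ∪ {w ∈ V : w interferes with v} be the closed anti-outneighborhood of v. Then |N⁺(v)| = (K − L)² for every node v ∈ V. -/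
/-- For a node `w = (p′, q′)` of the ICP (with `q′` zero-based),
`Avail K L w = {p′ + q′ + 1 + j (mod K) : j = 0, …, L−1}` is the set of users at which
the subfile represented by `w` is available. -/
def Avail (K : ℕ) [NeZero K] (L : ℕ) (w : ZMod K × Fin (K - L)) : Finset (ZMod K) :=
  (Finset.range L).image (fun j : ℕ => w.1 + (w.2.val : ZMod K) + 1 + (j : ZMod K))

/-- A node `w` interferes with `v = (p, q)` if `w ≠ v` and `p ∉ Avail w`;
the closed anti-outneighborhood `N⁺(v)` is `v` together with all nodes interfering
with `v`. -/
def Nplus (K : ℕ) [NeZero K] (L : ℕ) (v : ZMod K × Fin (K - L)) :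
    Finset (ZMod K × Fin (K - L)) :=
  insert v (Finset.univ.filter (fun w => w ≠ v ∧ v.1 ∉ Avail K L w))

theorem fst_notMem_Avail (K L : ℕ) [NeZero K] (v : ZMod K × Fin (K - L)) :
    v.1 ∉ Avail K L v := by
  simp only [Avail, Finset.mem_image, Finset.mem_range, not_exists, not_and]
  intro j hj h
  have hv := v.2.isLt
  have hzero : ((v.2.val + 1 + j : ℕ) : ZMod K) = 0 := by
    push_cast
    linear_combination h
  have := Nat.le_of_dvd (by omega) ((ZMod.natCast_eq_zero_iff _ _).mp hzero)
  omega

theorem Nplus_eq_filter (K L : ℕ) [NeZero K] (v : ZMod K × Fin (K - L)) :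
    Nplus K L v = Finset.univ.filter (fun w => v.1 ∉ Avail K L w) := by
  ext w
  by_cases h : w = v
  · simp [Nplus, h, fst_notMem_Avail]
  · simp [Nplus, h]

theorem card_image_sub_natCast_range {K L : ℕ} (hLK : L ≤ K) (a : ZMod K) :
    ((Finset.range L).image (fun j : ℕ => a - (j : ZMod K))).card = L := by
  rw [Finset.card_image_of_injOn, Finset.card_range]
  intro i hi j hj h
  simp only [Finset.coe_range, Set.mem_Iio] at hi hj
  have hij : (i : ZMod K) = j := sub_right_injective h
  rwa [ZMod.natCast_eq_natCast_iff', Nat.mod_eq_of_lt (by omega),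
    Nat.mod_eq_of_lt (by omega)] at hij

theorem card_filter_notMem_Avail {K L : ℕ} [NeZero K] (hLK : L ≤ K) (p : ZMod K)
    (q : Fin (K - L)) :
    (Finset.univ.filter (fun x : ZMod K => p ∉ Avail K L (x, q))).card = K - L := by
  have h : Finset.univ.filter (fun x : ZMod K => p ∉ Avail K L (x, q)) =
      ((Finset.range L).image (fun j : ℕ => p - (q.val : ZMod K) - 1 - (j : ZMod K)))ᶜ := by
    ext x
    simp only [Avail, Finset.mem_filter, Finset.mem_univ, true_and, Finset.mem_compl,
      Finset.mem_image, not_iff_not]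
    refine exists_congr fun j => and_congr_right fun _ => ⟨fun h => ?_, fun h => ?_⟩ <;>
      linear_combination -h
  rw [h, Finset.card_compl, ZMod.card, card_image_sub_natCast_range hLK]

/-- Every node of the ICP has closed anti-outneighborhood of cardinality `(K − L)²`. -/
theorem card_Nplus_eq (K L : ℕ) [NeZero K] (hL : 1 ≤ L) (hLK : L < K)
    (v : ZMod K × Fin (K - L)) :
    (Nplus K L v).card = (K - L) ^ 2 := by
  rw [Nplus_eq_filter, Finset.card_filter, Fintype.sum_prod_type_right]
  simp_rw [← Finset.card_filter, card_filter_notMem_Avail hLK.le]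
  simp [sq]
end

section
/- Let K, L, i be positive integers with i·L ≤ K, and let Ŝ be the collection of i-element subsets of ZMod K in which any two distinct elements are at cyclic distance at least L. For a ∈ ZMod K let W(a) = {a − L + 1, …, a} (mod K) and for s ∈ Ŝ let cov(s) = ⋃_{a∈s} W(a). Then for every p ∈ ZMod K, the number of sets s ∈ Ŝ with p ∉ cov(s) equals C(K − iL + i − 1, i). -/
/-- `cov K L s = ⋃_{a ∈ s} W a`, the set of users that can access the subfile stored
on the caches in `s`. -/
def cov (K : ℕ) [NeZero K] (L : ℕ) (s : Finset (ZMod K)) : Finset (ZMod K) :=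
  s.biUnion (W K L)

/-- `sparseSubsets L n i` is the collection of `i`-element subsets of `{0, …, n - 1}` in which
any two distinct elements differ by at least `L`. -/
def sparseSubsets (L n i : ℕ) : Finset (Finset ℕ) :=
  ((Finset.range n).powersetCard i).filter (fun s => ∀ a ∈ s, ∀ b ∈ s, a < b → a + L ≤ b)

theorem mem_sparseSubsets {L n i : ℕ} {s : Finset ℕ} :
    s ∈ sparseSubsets L n i ↔
      ((∀ a ∈ s, a < n) ∧ s.card = i) ∧ ∀ a ∈ s, ∀ b ∈ s, a < b → a + L ≤ b := by
  simp [sparseSubsets, Finset.mem_powersetCard, Finset.subset_iff]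

theorem sparseSubsets_succ_succ {L : ℕ} (hL : 0 < L) (n i : ℕ) :
    sparseSubsets L (n + 1) (i + 1) =
      sparseSubsets L n (i + 1) ∪ (sparseSubsets L (n + 1 - L) i).image (insert n) := by
  ext s
  simp only [Finset.mem_union, Finset.mem_image, mem_sparseSubsets]
  constructor
  · rintro ⟨⟨hn, hc⟩, hs⟩
    by_cases h : n ∈ s
    · refine Or.inr ⟨s.erase n, ⟨⟨fun a ha => ?_, ?_⟩, fun a ha b hb => ?_⟩,
        Finset.insert_erase h⟩
      · obtain ⟨hne, has⟩ := Finset.mem_erase.1 ha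
        have := hn a has
        have := hs a has n h (by omega)
        omega
      · rw [Finset.card_erase_of_mem h, hc]; rfl
      · exact hs a (Finset.mem_of_mem_erase ha) b (Finset.mem_of_mem_erase hb)
    · refine Or.inl ⟨⟨fun a ha => ?_, hc⟩, hs⟩
      have := hn a ha
      have : a ≠ n := fun e => h (e ▸ ha)
      omega
  · rintro (⟨⟨hn, hc⟩, hs⟩ | ⟨t, ⟨⟨hn, hc⟩, hs⟩, rfl⟩)
    · exact ⟨⟨fun a ha => (hn a ha).trans n.lt_succ_self, hc⟩, hs⟩
    · have hnt : n ∉ t := fun h => by have := hn n h; omega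
      refine ⟨⟨fun a ha => ?_, by rw [Finset.card_insert_of_notMem hnt, hc]⟩,
        fun a ha b hb hab => ?_⟩
      · rcases Finset.mem_insert.1 ha with rfl | ha
        · omega
        · have := hn a ha
          omega
      · rw [Finset.mem_insert] at ha hb
        rcases ha with rfl | ha <;> rcases hb with rfl | hb
        · omega
        · have := hn b hb
          omega
        · have := hn a ha
          omega
        · exact hs a ha b hb hab

theorem card_sparseSubsets_succ_succ {L : ℕ} (hL : 0 < L) (n i : ℕ) :
    (sparseSubsets L (n + 1) (i + 1)).card =
      (sparseSubsets L n (i + 1)).card + (sparseSubsets L (n + 1 - L) i).card := by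
  rw [sparseSubsets_succ_succ hL, Finset.card_union_of_disjoint, Finset.card_image_of_injOn]
  · intro s hs t ht hst
    have hns : n ∉ s := fun h => by have := (mem_sparseSubsets.1 hs).1.1 n h; omega
    have hnt : n ∉ t := fun h => by have := (mem_sparseSubsets.1 ht).1.1 n h; omega
    rw [← Finset.erase_insert hns, ← Finset.erase_insert hnt]
    exact congrArg (fun u => u.erase n) hst
  · refine Finset.disjoint_left.2 fun s hs hs' => ?_
    obtain ⟨t, -, rfl⟩ := Finset.mem_image.1 hs'
    exact lt_irrefl n ((mem_sparseSubsets.1 hs).1.1 n (Finset.mem_insert_self n t))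

theorem card_sparseSubsets {L : ℕ} (hL : 0 < L) (n i : ℕ) :
    (sparseSubsets L n i).card = (n + (L - 1) - i * (L - 1)).choose i := by
  obtain ⟨m, rfl⟩ : ∃ m, L = m + 1 := ⟨L - 1, by omega⟩
  rw [Nat.add_sub_cancel]
  induction i generalizing n with
  | zero =>
    rw [Nat.choose_zero_right, Finset.card_eq_one]
    refine ⟨∅, ?_⟩
    ext s
    rw [mem_sparseSubsets, Finset.mem_singleton, Finset.card_eq_zero]
    constructor
    · exact fun h => h.1.2
    · rintro rfl
      simp
  | succ i ih =>
    induction n with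
    | zero =>
      have hz : 0 + m - (i + 1) * m = 0 := by rw [Nat.succ_mul]; omega
      rw [hz, Nat.choose_zero_succ, Finset.card_eq_zero]
      simp [sparseSubsets]
    | succ n ihn =>
      rw [card_sparseSubsets_succ_succ hL, ihn, ih, Nat.succ_mul]
      rcases Nat.eq_zero_or_pos i with rfl | hi
      · simp
      · have him : m ≤ i * m := Nat.le_mul_of_pos_left m hi
        by_cases h : i * m ≤ n
        · rw [show n + 1 + m - (i * m + m) = (n - i * m) + 1 by omega,
            show n + m - (i * m + m) = n - i * m by omega,
            show n + 1 - (m + 1) + m - i * m = n - i * m by omega,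
            Nat.choose_succ_succ, add_comm]
        · rw [show n + 1 + m - (i * m + m) = 0 by omega,
            show n + m - (i * m + m) = 0 by omega,
            show n + 1 - (m + 1) + m - i * m = 0 by omega,
            Nat.choose_zero_succ, Nat.choose_eq_zero_of_lt hi]

theorem mem_W_iff {K : ℕ} [NeZero K] {L : ℕ} (hL : 0 < L) (p a : ZMod K) :
    p ∈ W K L a ↔ (a - p).val < L := by
  simp only [W, Finset.mem_image, Finset.mem_range]
  constructor
  · rintro ⟨j, hj, rfl⟩
    have h : a - (a - (L : ZMod K) + 1 + (j : ZMod K)) = ((L - 1 - j : ℕ) : ZMod K) := by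
      rw [Nat.cast_sub (by omega), Nat.cast_sub (by omega)]
      push_cast
      ring
    rw [h, ZMod.val_natCast]
    exact (Nat.mod_le _ _).trans_lt (by omega)
  · intro h
    refine ⟨L - 1 - (a - p).val, by omega, ?_⟩
    rw [Nat.cast_sub (by omega), Nat.cast_sub (by omega), ZMod.natCast_zmod_val]
    push_cast
    ring

theorem notMem_cov_iff {K : ℕ} [NeZero K] {L : ℕ} (hL : 0 < L) (p : ZMod K)
    (s : Finset (ZMod K)) : p ∉ cov K L s ↔ ∀ a ∈ s, L ≤ (a - p).val := by
  simp [cov, mem_W_iff hL]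

/-- The element of `ZMod K` at clockwise distance `L + n` from `p`. -/
def offset (K : ℕ) (L : ℕ) (p : ZMod K) (n : ℕ) : ZMod K := p + ((n + L : ℕ) : ZMod K)

theorem val_offset_sub {K L : ℕ} {p : ZMod K} {n : ℕ} (hn : n < K - L) :
    (offset K L p n - p).val = n + L := by
  rw [offset, add_sub_cancel_left, ZMod.val_natCast_of_lt (by omega)]

theorem offset_val_sub {K : ℕ} [NeZero K] {L : ℕ} {p a : ZMod K} (h : L ≤ (a - p).val) :
    offset K L p ((a - p).val - L) = a := by
  rw [offset, Nat.sub_add_cancel h, ZMod.natCast_zmod_val, add_sub_cancel]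

theorem val_sub_eq {K : ℕ} [NeZero K] (p : ZMod K) {a b : ZMod K}
    (h : (a - p).val ≤ (b - p).val) : (b - a).val = (b - p).val - (a - p).val := by
  rw [← ZMod.val_sub h, sub_sub_sub_cancel_right]

theorem le_cyclicDist_iff {K : ℕ} [NeZero K] {L : ℕ} {p a b : ZMod K}
    (ha : L ≤ (a - p).val) (hb : L ≤ (b - p).val) (hab : a ≠ b) :
    (L ≤ (a - b).val ∧ L ≤ K - (a - b).val) ↔
      (a - p).val + L ≤ (b - p).val ∨ (b - p).val + L ≤ (a - p).val := by
  have hne : (a - p).val ≠ (b - p).val := fun h => hab (sub_left_injective (ZMod.val_injective K h))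
  have hak := ZMod.val_lt (a - p)
  have hbk := ZMod.val_lt (b - p)
  rcases le_total (a - p).val (b - p).val with h | h
  · have hv : (a - b).val = K - (b - a).val := by
      rw [← neg_sub b a, ZMod.neg_val, if_neg (sub_ne_zero.2 hab.symm)]
    rw [hv, val_sub_eq p h]
    omega
  · rw [val_sub_eq p h]
    omega

/-- Every user `p` needs exactly `C(K − iL + i − 1, i)` subfiles: the number of
`s ∈ Ŝ` with `p ∉ cov(s)`. -/
theorem card_Shat_not_covering (K : ℕ) [NeZero K] (L i : ℕ)
    (hL : 0 < L) (hi : 0 < i) (hiL : i * L ≤ K) (p : ZMod K) :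
    ((Shat K L i).filter (fun s => p ∉ cov K L s)).card
      = Nat.choose (K - i * L + i - 1) i := by
  have hLK : L ≤ K := (Nat.le_mul_of_pos_left L hi).trans hiL
  have hn : K - i * L + i - 1 = K - L + (L - 1) - i * (L - 1) := by
    have : i ≤ i * L := Nat.le_mul_of_pos_right i hL
    rw [Nat.mul_sub_one]
    omega
  rw [hn, ← card_sparseSubsets hL]
  have hright {s : Finset (ZMod K)} (hs : ∀ a ∈ s, L ≤ (a - p).val) :
      (s.image fun a => (a - p).val - L).image (offset K L p) = s := by
    rw [Finset.image_image]
    exact (Finset.image_congr fun a ha => offset_val_sub (hs a ha)).trans Finset.image_id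
  have hleft {t : Finset ℕ} (ht : ∀ n ∈ t, n < K - L) :
      (t.image (offset K L p)).image (fun a => (a - p).val - L) = t := by
    rw [Finset.image_image]
    refine (Finset.image_congr fun n hn => ?_).trans Finset.image_id
    simp [val_offset_sub (ht n hn)]
  have hcard {s : Finset (ZMod K)} (hs : ∀ a ∈ s, L ≤ (a - p).val) :
      (s.image fun a => (a - p).val - L).card = s.card :=
    le_antisymm Finset.card_image_le <| by
      conv_lhs => rw [← hright hs]
      exact Finset.card_image_le
  refine Finset.card_nbij' (fun s => s.image fun a => (a - p).val - L)
    (fun t => t.image (offset K L p)) ?_ ?_ ?_ ?_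
  · intro s hs
    simp only [Finset.coe_filter, Set.mem_ofPred_eq, Shat, Finset.mem_filter, Finset.mem_univ,
      true_and, notMem_cov_iff hL] at hs
    obtain ⟨⟨hc, hd⟩, hp⟩ := hs
    refine mem_sparseSubsets.2 ⟨⟨?_, by rw [hcard hp, hc]⟩, ?_⟩
    · simp only [Finset.forall_mem_image]
      intro a ha
      have := hp a ha
      have := ZMod.val_lt (a - p)
      omega
    · simp only [Finset.forall_mem_image]
      intro a ha b hb hab
      have hne : a ≠ b := by
        rintro rfl
        exact lt_irrefl _ hab
      have := (le_cyclicDist_iff (hp a ha) (hp b hb) hne).1 (hd a ha b hb hne)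
      have := hp a ha
      omega
  · intro t ht
    obtain ⟨⟨hn, hc⟩, hs⟩ := mem_sparseSubsets.1 ht
    have hp : ∀ a ∈ t.image (offset K L p), L ≤ (a - p).val := by
      simp only [Finset.forall_mem_image]
      intro n hnt
      rw [val_offset_sub (hn n hnt)]
      omega
    simp only [Finset.coe_filter, Set.mem_ofPred_eq, Shat, Finset.mem_filter, Finset.mem_univ,
      true_and, notMem_cov_iff hL]
    refine ⟨⟨by rw [← hcard hp, hleft hn, hc], fun a ha b hb hab => ?_⟩, hp⟩
    rw [le_cyclicDist_iff (hp a ha) (hp b hb) hab]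
    obtain ⟨m, hm, rfl⟩ := Finset.mem_image.1 ha
    obtain ⟨n, hnt, rfl⟩ := Finset.mem_image.1 hb
    rw [val_offset_sub (hn m hm), val_offset_sub (hn n hnt)]
    rcases lt_trichotomy m n with h | rfl | h
    · have := hs m hm n hnt h
      omega
    · exact absurd rfl hab
    · have := hs n hnt m hm h
      omega
  · intro s hs
    simp only [Finset.coe_filter, Set.mem_ofPred_eq, notMem_cov_iff hL] at hs
    exact hright hs.2
  · intro t ht
    exact hleft (mem_sparseSubsets.1 ht).1.1
end

section
/- Let s ≥ 2 and K be positive integers with s ∣ K and K/s ≥ 2, and set L = K − K/s + 1 (so K/2 ≤ L < K). On the node set V = (ZMod K) × Fin (K−L), with Avail(p′, q′) = {p′ + q′ + 1 + j (mod K) : j = 0, …, L−1} and interference as defined, there exists a proper coloring c : V → ℕ (c(w) ≠ c(v) whenever w interferes with v) such that for every node v, the set of colors appearing on the closed anti-outneighborhood N⁺(v) = {v} ∪ {w : w interferes with v} has cardinality at most (K−L)(K−L+1)/2. -/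
/-- A user at which the subfile represented by `w` is not available precedes `w.1 + w.2`
cyclically by fewer than `K - L` steps. -/
theorem exists_add_eq_of_notMem_avail {K : ℕ} [NeZero K] {L : ℕ} (w : ZMod K × Fin (K - L))
    {p : ZMod K} (hp : p ∉ Avail K L w) :
    ∃ t < K - L, w.1 + (w.2.val : ZMod K) = p + (t : ZMod K) := by
  set x : ZMod K := p - (w.1 + (w.2.val : ZMod K) + 1) with hx
  have hxK : x.val < K := ZMod.val_lt x
  have hcast : ((x.val : ℕ) : ZMod K) = x := ZMod.natCast_zmod_val x
  have hL : L ≤ x.val := by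
    by_contra! h
    refine hp (Finset.mem_image.2 ⟨x.val, Finset.mem_range.2 h, ?_⟩)
    rw [hcast, hx]
    ring
  refine ⟨K - 1 - x.val, by omega, ?_⟩
  have hsum : ((K - 1 - x.val + x.val + 1 : ℕ) : ZMod K) = 0 := by
    rw [show K - 1 - x.val + x.val + 1 = K by omega, ZMod.natCast_self]
  push_cast [hcast] at hsum
  linear_combination (-1 : ZMod K) * hsum + hx

theorem natCast_zmod_inj_of_lt {m a b : ℕ} (ha : a < m) (hb : b < m)
    (h : (a : ZMod m) = (b : ZMod m)) : a = b := by
  rw [ZMod.natCast_eq_natCast_iff'] at h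
  rwa [Nat.mod_eq_of_lt ha, Nat.mod_eq_of_lt hb] at h

/-- For `L = K − K/s + 1` with `s ∣ K`, `s ≥ 2`, `K/s ≥ 2`, there is a proper coloring
of the ICP such that at most `(K−L)(K−L+1)/2` colors appear on the closed
anti-outneighborhood of any node. -/
theorem coloring_L_eq_K_sub_K_div_s_add_one (K s : ℕ) [NeZero K]
    (hs : 2 ≤ s) (hdvd : s ∣ K) (hKs : 2 ≤ K / s) :
    ∃ c : ZMod K × Fin (K - (K - K / s + 1)) → ℕ,
      (∀ v w : ZMod K × Fin (K - (K - K / s + 1)),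
          (w ≠ v ∧ v.1 ∉ Avail K (K - K / s + 1) w) → c w ≠ c v) ∧
        ∀ v : ZMod K × Fin (K - (K - K / s + 1)),
          ((insert v (Finset.univ.filter
              (fun w : ZMod K × Fin (K - (K - K / s + 1)) =>
                w ≠ v ∧ v.1 ∉ Avail K (K - K / s + 1) w))).image c).card
            ≤ (K - (K - K / s + 1)) * ((K - (K - K / s + 1)) + 1) / 2 := by
  have hmK : K / s ∣ K := Nat.div_dvd_of_dvd hdvd
  have hle : K / s ≤ K := Nat.div_le_self K s
  have hn : K - (K - K / s + 1) = K / s - 1 := by omega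
  have hbound : (K - (K - K / s + 1)) * ((K - (K - K / s + 1)) + 1) / 2 = (K / s).choose 2 := by
    rw [hn, Nat.choose_two_right, Nat.sub_add_cancel (by omega), Nat.mul_comm]
  rw [hbound]
  generalize K / s = m at *
  generalize K - m + 1 = L at *
  have : NeZero m := ⟨by omega⟩
  let φ : ZMod K →+* ZMod m := ZMod.castHom hmK (ZMod m)
  let pair : ZMod K × Fin (K - L) → Sym2 (ZMod m) :=
    fun w => s(φ w.1 - 1, φ w.1 + (w.2.val : ZMod m))
  let e : Sym2 (ZMod m) ≃ Fin (Fintype.card (Sym2 (ZMod m))) := Fintype.equivFin _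
  have hsucc : ∀ t < K - L, ((t + 1 : ℕ) : ZMod m) ≠ 0 := fun t ht h => by
    have := natCast_zmod_inj_of_lt (m := m) (a := t + 1) (b := 0) (by omega) (by omega)
      (by simpa using h)
    omega
  refine ⟨fun w => (e (pair w)).val, ?_, fun v => ?_⟩
  · rintro ⟨p, q⟩ ⟨p', q'⟩ ⟨hne, hav⟩ hc
    obtain ⟨t, ht, hpt⟩ := exists_add_eq_of_notMem_avail _ hav
    have hφ : φ p' + (q'.val : ZMod m) = φ p + (t : ZMod m) := by
      simpa using congrArg φ hpt
    have hpair : pair (p', q') = pair (p, q) := e.injective (Fin.ext hc)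
    have hq := q.isLt
    have hq' := q'.isLt
    rcases Sym2.eq_iff.1 hpair with ⟨h1, h2⟩ | ⟨h1, h2⟩
    · have hqq : q'.val = q.val := natCast_zmod_inj_of_lt (m := m) (by omega) (by omega)
        (by linear_combination h2 - h1)
      have hqt : q'.val = t := natCast_zmod_inj_of_lt (m := m) (by omega) (by omega)
        (by linear_combination hφ - h1)
      refine hne (Prod.ext ?_ (Fin.ext hqq))
      simpa [hqt] using hpt
    · refine hsucc t ht ?_
      push_cast
      linear_combination h2 - hφ
  · calc _ ≤ ((Finset.univ.filter fun z : Sym2 (ZMod m) => ¬ z.IsDiag).image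
            fun z => (e z).val).card := by
          refine Finset.card_le_card fun x hx => ?_
          obtain ⟨w, -, rfl⟩ := Finset.mem_image.1 hx
          refine Finset.mem_image.2 ⟨pair w, Finset.mem_filter.2 ⟨Finset.mem_univ _, ?_⟩, rfl⟩
          intro hd
          refine hsucc _ w.2.isLt ?_
          have hd' := Sym2.mk_isDiag_iff.1 hd
          push_cast
          linear_combination -hd'
      _ ≤ (Finset.univ.filter fun z : Sym2 (ZMod m) => ¬ z.IsDiag).card := Finset.card_image_le
      _ = m.choose 2 := by
          rw [← Fintype.card_subtype, Sym2.card_subtype_not_diag, ZMod.card]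
end
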